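/- Let A be a Banach algebra and J a closed two-sided ideal of A. Suppose that J has a bounded right approximate identity, and that there exists x₀ ∈ J such that x₀ does not lie in the closure of the set Jx₀ = {y x₀ : y ∈ J}. Then A is not amenable. -/

import Mathlib

open scoped TensorProduct ENNReal
open MeasureTheory Filter

noncomputable section

/-- The projective tensor norm of an element of the algebraic tensor product `A ⊗[ℂ] A`;
the projective tensor product `A ⊗̂ A` is the completion of `A ⊗[ℂ] A` in this norm, and a
net in `A ⊗̂ A` witnessing an approximate diagonal may always be taken in the dense
subspace `A ⊗[ℂ] A`. -/
def projNorm {A : Type*} [NonUnitalNormedRing A] [NormedSpace ℂ A]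
    (u : TensorProduct ℂ A A) : ℝ :=
  sInf { r : ℝ | ∃ l : List (A × A), u = (l.map fun p => p.1 ⊗ₜ[ℂ] p.2).sum ∧
      r = (l.map fun p => ‖p.1‖ * ‖p.2‖).sum }

/-- The left `A`-bimodule action on `A ⊗ A`: `a • (x ⊗ y) = (a*x) ⊗ y`. -/
def diagL {A : Type*} [NonUnitalNormedRing A] [NormedSpace ℂ A]
    [SMulCommClass ℂ A A] [IsScalarTower ℂ A A]
    (a : A) (u : TensorProduct ℂ A A) : TensorProduct ℂ A A :=
  TensorProduct.map (LinearMap.mulLeft ℂ a) LinearMap.id u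

/-- The right `A`-bimodule action on `A ⊗ A`: `(x ⊗ y) • a = x ⊗ (y*a)`. -/
def diagR {A : Type*} [NonUnitalNormedRing A] [NormedSpace ℂ A]
    [SMulCommClass ℂ A A] [IsScalarTower ℂ A A]
    (a : A) (u : TensorProduct ℂ A A) : TensorProduct ℂ A A :=
  TensorProduct.map LinearMap.id (LinearMap.mulRight ℂ a) u

/-- The multiplication map `π : A ⊗ A → A`, `π(x ⊗ y) = x*y`. -/
def tensMul {A : Type*} [NonUnitalNormedRing A] [NormedSpace ℂ A]
    [SMulCommClass ℂ A A] [IsScalarTower ℂ A A] :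
    TensorProduct ℂ A A →ₗ[ℂ] A :=
  TensorProduct.lift (LinearMap.mul ℂ A)

/-- `A` has a (not necessarily bounded) approximate diagonal: a net `(d_α)` in `A ⊗̂ A`
with `‖a·d_α − d_α·a‖ → 0` and `‖a π(d_α) − a‖ → 0` for every `a ∈ A`.  This is formulated
via the equivalent cofinal finite-set/ε criterion (the net is then indexed by pairs
`(S, ε)` ordered by inclusion/refinement). -/
def HasApproxDiagonal (A : Type*) [NonUnitalNormedRing A] [NormedSpace ℂ A]
    [SMulCommClass ℂ A A] [IsScalarTower ℂ A A] : Prop :=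
  ∀ (S : Finset A) (ε : ℝ), 0 < ε → ∃ u : TensorProduct ℂ A A,
    ∀ a ∈ S, projNorm (diagL a u - diagR a u) < ε ∧ ‖a * tensMul u - a‖ < ε

/-- `A` is amenable: it has a bounded approximate diagonal. -/
def IsAmenable (A : Type*) [NonUnitalNormedRing A] [NormedSpace ℂ A]
    [SMulCommClass ℂ A A] [IsScalarTower ℂ A A] : Prop :=
  ∃ C : ℝ, ∀ (S : Finset A) (ε : ℝ), 0 < ε → ∃ u : TensorProduct ℂ A A,
    projNorm u ≤ C ∧
    ∀ a ∈ S, projNorm (diagL a u - diagR a u) < ε ∧ ‖a * tensMul u - a‖ < ε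

/-- `A` is approximately amenable: its forced unitization `A# = ℂ ⊕ A` (equipped with the
ℓ¹ norm `‖(λ, a)‖ = ‖λ‖ + ‖a‖`) has a, not necessarily bounded, approximate diagonal. -/
def IsApproxAmenable (A : Type*) [NonUnitalNormedRing A] [NormedSpace ℂ A]
    [SMulCommClass ℂ A A] [IsScalarTower ℂ A A] : Prop :=
  HasApproxDiagonal (WithLp 1 (Unitization ℂ A))

/-- A subset `J` of a normed algebra has a bounded right approximate identity: a norm-bounded
net `(e_α)` in `J` with `‖x - x * e_α‖ → 0` for every `x ∈ J` (equivalently, formulated via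
the cofinal finite-set/ε criterion). -/
def HasBoundedRightApproxId {A : Type*} [NonUnitalNormedRing A] (J : Set A) : Prop :=
  ∃ C : ℝ, ∀ (F : Finset A), (∀ x ∈ F, x ∈ J) → ∀ ε : ℝ, 0 < ε →
    ∃ e ∈ J, ‖e‖ ≤ C ∧ ∀ x ∈ F, ‖x - x * e‖ < ε

/-- A subset `J` of a normed algebra has a bounded left approximate identity: a norm-bounded
net `(e_α)` in `J` with `‖x - e_α * x‖ → 0` for every `x ∈ J`. -/
def HasBoundedLeftApproxId {A : Type*} [NonUnitalNormedRing A] (J : Set A) : Prop :=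
  ∃ C : ℝ, ∀ (F : Finset A), (∀ x ∈ F, x ∈ J) → ∀ ε : ℝ, 0 < ε →
    ∃ e ∈ J, ‖e‖ ≤ C ∧ ∀ x ∈ F, ‖x - e * x‖ < ε

/-- A subset `J` of a normed algebra has a (not necessarily bounded) left approximate
identity: a net `(v_β)` in `J` with `‖x - v_β * x‖ → 0` for every `x ∈ J`. -/
def HasLeftApproxId {A : Type*} [NonUnitalNormedRing A] (J : Set A) : Prop :=
  ∀ (F : Finset A), (∀ x ∈ F, x ∈ J) → ∀ ε : ℝ, 0 < ε →
    ∃ v ∈ J, ∀ x ∈ F, ‖x - v * x‖ < ε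

section ProjectiveTensor

variable {A : Type*} [NonUnitalNormedRing A] [NormedSpace ℂ A]

theorem exists_list_eq_sum_tmul (u : TensorProduct ℂ A A) :
    ∃ l : List (A × A), u = (l.map fun p => p.1 ⊗ₜ[ℂ] p.2).sum := by
  induction u using TensorProduct.induction_on with
  | zero => exact ⟨[], by simp⟩
  | tmul x y => exact ⟨[(x, y)], by simp⟩
  | add u v hu hv =>
    obtain ⟨l, rfl⟩ := hu
    obtain ⟨m, rfl⟩ := hv
    exact ⟨l ++ m, by simp⟩

theorem exists_list_of_projNorm_lt {u : TensorProduct ℂ A A} {ε : ℝ} (h : projNorm u < ε) :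
    ∃ l : List (A × A), u = (l.map fun p => p.1 ⊗ₜ[ℂ] p.2).sum ∧
      (l.map fun p => ‖p.1‖ * ‖p.2‖).sum < ε := by
  obtain ⟨l₀, hl₀⟩ := exists_list_eq_sum_tmul u
  rw [projNorm] at h
  have hne : { r : ℝ | ∃ l : List (A × A), u = (l.map fun p => p.1 ⊗ₜ[ℂ] p.2).sum ∧
      r = (l.map fun p => ‖p.1‖ * ‖p.2‖).sum }.Nonempty := ⟨_, l₀, hl₀, rfl⟩
  obtain ⟨_, ⟨l, hl, rfl⟩, hr⟩ := exists_lt_of_csInf_lt hne h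
  exact ⟨l, hl, hr⟩

variable [SMulCommClass ℂ A A] [IsScalarTower ℂ A A]

/-- The linear map `A ⊗ A → A` sending `x ⊗ y` to `x * e * y`. -/
def sandwich (e : A) : TensorProduct ℂ A A →ₗ[ℂ] A :=
  tensMul ∘ₗ TensorProduct.map (LinearMap.mulRight ℂ e) LinearMap.id

@[simp]
theorem sandwich_tmul (e x y : A) : sandwich e (x ⊗ₜ[ℂ] y) = x * e * y := by
  simp [sandwich, tensMul]

theorem sandwich_diagR (e a : A) (u : TensorProduct ℂ A A) :
    sandwich e (diagR a u) = sandwich e u * a := by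
  induction u using TensorProduct.induction_on with
  | zero => simp [diagR]
  | tmul x y => simp [diagR, mul_assoc]
  | add u v hu hv =>
    simp only [diagR, map_add, add_mul] at hu hv ⊢
    rw [hu, hv]

theorem norm_sandwich_list_sum_le (e : A) (l : List (A × A)) :
    ‖sandwich e (l.map fun p => p.1 ⊗ₜ[ℂ] p.2).sum‖ ≤
      ‖e‖ * (l.map fun p => ‖p.1‖ * ‖p.2‖).sum := by
  induction l with
  | nil => simp
  | cons p l ih =>
    simp only [List.map_cons, List.sum_cons, map_add, sandwich_tmul, mul_add]
    refine (norm_add_le _ _).trans (add_le_add ?_ ih)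
    calc ‖p.1 * e * p.2‖ ≤ ‖p.1‖ * ‖e‖ * ‖p.2‖ :=
          (norm_mul_le _ _).trans (by gcongr; exact norm_mul_le _ _)
      _ = ‖e‖ * (‖p.1‖ * ‖p.2‖) := by ring

theorem norm_sandwich_le_of_projNorm_lt (e : A) {u : TensorProduct ℂ A A} {ε : ℝ}
    (h : projNorm u < ε) : ‖sandwich e u‖ ≤ ‖e‖ * ε := by
  obtain ⟨l, rfl, hl⟩ := exists_list_of_projNorm_lt h
  exact (norm_sandwich_list_sum_le e l).trans (by gcongr)

theorem sandwich_mem {J : Submodule ℂ A} (hJr : ∀ a ∈ J, ∀ b : A, a * b ∈ J)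
    (hJl : ∀ a ∈ J, ∀ b : A, b * a ∈ J) {e : A} (he : e ∈ J) (u : TensorProduct ℂ A A) :
    sandwich e u ∈ J := by
  induction u using TensorProduct.induction_on with
  | zero => simp
  | tmul x y => simpa using hJr _ (hJl _ he x) y
  | add u v hu hv => simpa using J.add_mem hu hv

theorem norm_mul_tensMul_sub_sandwich_diagL_le (x e : A) {δ : ℝ} (l : List (A × A))
    (h : ∀ p ∈ l, ‖x * p.1 - x * p.1 * e‖ ≤ δ) :
    ‖x * tensMul (l.map fun p => p.1 ⊗ₜ[ℂ] p.2).sum -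
        sandwich e (diagL x (l.map fun p => p.1 ⊗ₜ[ℂ] p.2).sum)‖ ≤
      δ * (l.map fun p => ‖p.2‖).sum := by
  induction l with
  | nil => simp [diagL]
  | cons p l ih =>
    have hp := h p (by simp)
    have ih := ih fun q hq => h q (by simp [hq])
    simp only [diagL] at ih ⊢
    simp only [List.map_cons, List.sum_cons, map_add, mul_add, TensorProduct.map_tmul,
      sandwich_tmul, LinearMap.mulLeft_apply, LinearMap.id_apply]
    rw [add_sub_add_comm]
    refine (norm_add_le _ _).trans (add_le_add ?_ ih)
    have : x * tensMul (p.1 ⊗ₜ[ℂ] p.2) - x * p.1 * e * p.2 =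
        (x * p.1 - x * p.1 * e) * p.2 := by
      simp [tensMul, sub_mul, mul_assoc]
    rw [this]
    exact (norm_mul_le _ _).trans (by gcongr)

/-- If `∑ aᵢ ⊗ bᵢ` is far along an approximate diagonal and `e` far along a bounded right
approximate identity of the ideal `J`, then `∑ aᵢ * e * bᵢ` lies in `J` and is almost a left
identity for `x`. -/
theorem mem_closure_mul_of_hasApproxDiagonal (hA : HasApproxDiagonal A) {J : Submodule ℂ A}
    (hJr : ∀ a ∈ J, ∀ b : A, a * b ∈ J) (hJl : ∀ a ∈ J, ∀ b : A, b * a ∈ J)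
    (hRAI : HasBoundedRightApproxId (J : Set A)) {x : A} (hx : x ∈ J) :
    x ∈ closure {z : A | ∃ y ∈ J, z = y * x} := by
  classical
  obtain ⟨C, hC⟩ := hRAI
  have hC0 : 0 ≤ C := by
    obtain ⟨e, -, he, -⟩ := hC ∅ (by simp) 1 one_pos
    exact (norm_nonneg e).trans he
  rw [Metric.mem_closure_iff]
  intro ε hε
  have hη : 0 < ε / (C + 3) := by positivity
  obtain ⟨u, hu⟩ := hA {x} (ε / (C + 3)) hη
  obtain ⟨hcomm, hunit⟩ := hu x (by simp)
  obtain ⟨l, hl⟩ := exists_list_eq_sum_tmul u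
  have hS : 0 ≤ (l.map fun p => ‖p.2‖).sum := List.sum_nonneg fun r hr => by
    obtain ⟨p, -, rfl⟩ := List.mem_map.1 hr
    exact norm_nonneg _
  obtain ⟨e, heJ, heC, he⟩ := hC (l.map fun p => x * p.1).toFinset
    (by
      intro z hz
      obtain ⟨p, -, rfl⟩ := List.mem_map.1 (List.mem_toFinset.1 hz)
      exact hJr _ hx _)
    (ε / (C + 3) / ((l.map fun p => ‖p.2‖).sum + 1)) (by positivity)
  have h₁ : ‖x * tensMul u - sandwich e (diagL x u)‖ ≤ ε / (C + 3) := by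
    rw [hl]
    refine (norm_mul_tensMul_sub_sandwich_diagL_le x e l fun p hp =>
      (he _ (List.mem_toFinset.2 (List.mem_map_of_mem hp))).le).trans ?_
    rw [div_mul_eq_mul_div, div_le_iff₀ (by positivity)]
    gcongr
    linarith
  have h₂ : ‖sandwich e (diagL x u) - sandwich e u * x‖ ≤ C * (ε / (C + 3)) := by
    rw [← sandwich_diagR, ← map_sub]
    exact (norm_sandwich_le_of_projNorm_lt e hcomm).trans (by gcongr)
  refine ⟨sandwich e u * x, ⟨_, sandwich_mem hJr hJl heJ u, rfl⟩, ?_⟩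
  rw [dist_eq_norm]
  calc ‖x - sandwich e u * x‖
      = ‖-(x * tensMul u - x) + (x * tensMul u - sandwich e (diagL x u)) +
          (sandwich e (diagL x u) - sandwich e u * x)‖ := by congr 1; abel
    _ ≤ ‖x * tensMul u - x‖ + ‖x * tensMul u - sandwich e (diagL x u)‖ +
          ‖sandwich e (diagL x u) - sandwich e u * x‖ := by
        simpa only [norm_neg] using norm_add₃_le (a := -(x * tensMul u - x))
    _ < (C + 3) * (ε / (C + 3)) := by linarith
    _ = ε := by field_simp

theorem IsAmenable.hasApproxDiagonal (h : IsAmenable A) : HasApproxDiagonal A := by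
  obtain ⟨C, hC⟩ := h
  intro S ε hε
  obtain ⟨u, -, hu⟩ := hC S ε hε
  exact ⟨u, hu⟩

end ProjectiveTensor

/-- If a Banach algebra `A` has a closed two-sided ideal `J` with a bounded right approximate
identity and some `x₀ ∈ J` with `x₀ ∉ closure (J x₀)`, then `A` is not amenable. -/
theorem obstruction_to_amenability
    {A : Type*} [NonUnitalNormedRing A] [NormedSpace ℂ A]
    [SMulCommClass ℂ A A] [IsScalarTower ℂ A A] [CompleteSpace A]
    (J : Submodule ℂ A) (hJclosed : IsClosed (J : Set A))
    (hJmul_right : ∀ a ∈ J, ∀ b : A, a * b ∈ J)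
    (hJmul_left : ∀ a ∈ J, ∀ b : A, b * a ∈ J)
    (hRAI : HasBoundedRightApproxId (J : Set A))
    (x₀ : A) (hx₀ : x₀ ∈ J)
    (hx₀' : x₀ ∉ closure {z : A | ∃ y ∈ J, z = y * x₀}) :
    ¬ IsAmenable A := by
  exact fun h =>
    hx₀' (mem_closure_mul_of_hasApproxDiagonal h.hasApproxDiagonal hJmul_right hJmul_left hRAI hx₀)
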